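/- Let λ1, λ2, λ3 ∈ ℝ be such that the quadratic polynomial λ3(1 − λ2)x² + (λ1 + λ2 − λ3 − 1)x + (1 − λ1) has two distinct real roots. Then the set of 6-tuples (L1⁺, L1⁻, L2⁺, L2⁻, L3⁺, L3⁻) of pairwise transverse Lagrangian subspaces of (ℝ^{2n}, ω) satisfying [L2⁺,L2⁻;L3⁺,L3⁻] = λ1·id, [L1⁺,L1⁻;L3⁺,L3⁻] = λ2·id, and [L1⁺,L1⁻;L2⁺,L2⁻] = λ3·id decomposes into finitely many orbits under the diagonal action of Sp(2n,ℝ): there is a finite set F of such 6-tuples so that every such 6-tuple is obtained from a member of F by applying some g ∈ Sp(2n,ℝ) to all six Lagrangians. -/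

import Mathlib

open Module Submodule

/-- `ℝ^{2n} = ℝⁿ × ℝⁿ`. -/
abbrev SympV (n : ℕ) := (Fin n → ℝ) × (Fin n → ℝ)

/-- The standard symplectic form `ω((x,y),(x',y')) = ⟨x,y'⟩ - ⟨y,x'⟩`. -/
def stdOmega (n : ℕ) (p q : SympV n) : ℝ :=
  (∑ i, p.1 i * q.2 i) - ∑ i, p.2 i * q.1 i

/-- A Lagrangian: an `n`-dimensional subspace on which `ω` vanishes identically. -/
def IsLagrangian (n : ℕ) (L : Submodule ℝ (SympV n)) : Prop :=
  finrank ℝ L = n ∧ ∀ u ∈ L, ∀ v ∈ L, stdOmega n u v = 0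

/-- Membership in `Sp(2n,ℝ)` for a linear automorphism of `ℝ^{2n}`. -/
def IsSymplectic (n : ℕ) (g : SympV n ≃ₗ[ℝ] SympV n) : Prop :=
  ∀ u v, stdOmega n (g u) (g v) = stdOmega n u v

/-- The projection onto `U` with kernel `W`, as an endomorphism. -/
noncomputable def projTo {V : Type*} [AddCommGroup V] [Module ℝ V]
    (U W : Submodule ℝ V) (h : IsCompl U W) : V →ₗ[ℝ] V :=
  U.subtype ∘ₗ U.linearProjOfIsCompl W h

/-- The generalized cross-ratio `[U1,U2;U3,U4]` as an endomorphism of `U1`. -/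
noncomputable def crossRatio {V : Type*} [AddCommGroup V] [Module ℝ V]
    (U1 U2 U3 U4 : Submodule ℝ V)
    (h12 : IsCompl U1 U2) (h34 : IsCompl U3 U4) : U1 →ₗ[ℝ] U1 :=
  (U1.linearProjOfIsCompl U2 h12) ∘ₗ (projTo U3 U4 h34) ∘ₗ U1.subtype

/-- A 6-tuple `(L i b)` of pairwise transverse Lagrangians of `ℝ^{2n}` with the three
scalar cross-ratios `[L2⁺,L2⁻;L3⁺,L3⁻] = λ1·id`, `[L1⁺,L1⁻;L3⁺,L3⁻] = λ2·id`,
`[L1⁺,L1⁻;L2⁺,L2⁻] = λ3·id`. -/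
def GoodLagTuple (n : ℕ) (l1 l2 l3 : ℝ)
    (L : Fin 3 → Bool → Submodule ℝ (SympV n)) : Prop :=
  (∀ i b, IsLagrangian n (L i b)) ∧
  (∀ i b j b', (i, b) ≠ (j, b') → IsCompl (L i b) (L j b')) ∧
  (∀ (h : IsCompl (L 1 true) (L 1 false)) (h' : IsCompl (L 2 true) (L 2 false)),
    crossRatio (L 1 true) (L 1 false) (L 2 true) (L 2 false) h h' = l1 • LinearMap.id) ∧
  (∀ (h : IsCompl (L 0 true) (L 0 false)) (h' : IsCompl (L 2 true) (L 2 false)),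
    crossRatio (L 0 true) (L 0 false) (L 2 true) (L 2 false) h h' = l2 • LinearMap.id) ∧
  (∀ (h : IsCompl (L 0 true) (L 0 false)) (h' : IsCompl (L 1 true) (L 1 false)),
    crossRatio (L 0 true) (L 0 false) (L 1 true) (L 1 false) h h' = l3 • LinearMap.id)

/-- A self-adjoint operator annihilated by `(X - s)(X - t)` with `s ≠ t` has an eigenbasis that is
orthogonal for the given symmetric form. -/
theorem exists_orthogonal_eigenbasis {U : Type*} [AddCommGroup U] [Module ℝ U]
    [FiniteDimensional ℝ U] {b : LinearMap.BilinForm ℝ U} (hb : b.IsSymm) {T : U →ₗ[ℝ] U}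
    (hT : ∀ u v, b (T u) v = b u (T v)) {s t : ℝ} (hst : s ≠ t)
    (hq : ∀ u, T (T u) - (s + t) • T u + (s * t) • u = 0) :
    ∃ (v : Basis (Fin (finrank ℝ U)) ℝ U) (τ : Fin (finrank ℝ U) → ℝ),
      (∀ i, τ i = s ∨ τ i = t) ∧ (∀ i, T (v i) = τ i • v i) ∧ b.IsOrthoᵢ v := by
  set E₁ := LinearMap.ker (T - s • LinearMap.id) with hE₁
  set E₂ := LinearMap.ker (T - t • LinearMap.id) with hE₂
  have mem₁ (u : U) : u ∈ E₁ ↔ T u = s • u := by simp [hE₁, sub_eq_zero]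
  have mem₂ (u : U) : u ∈ E₂ ↔ T u = t • u := by simp [hE₂, sub_eq_zero]
  have hst' : s - t ≠ 0 := sub_ne_zero.mpr hst
  have hE : IsCompl E₁ E₂ := by
    refine ⟨Submodule.disjoint_def.mpr fun u h₁ h₂ => ?_,
      Submodule.codisjoint_iff_exists_add_eq.mpr fun u => ?_⟩
    · rw [mem₁] at h₁
      rw [mem₂, h₁] at h₂
      have : (s - t) • u = 0 := by rw [sub_smul, h₂, sub_self]
      exact (smul_eq_zero.mp this).resolve_left hst'
    · have key : T (T u) = (s + t) • T u - (s * t) • u := by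
        rw [← sub_eq_zero, ← hq u]
        abel
      refine ⟨(s - t)⁻¹ • (T u - t • u), -((s - t)⁻¹ • (T u - s • u)), ?_, ?_, ?_⟩
      · rw [mem₁, map_smul, map_sub, map_smul, key]
        module
      · rw [mem₂, map_neg, map_smul, map_sub, map_smul, key]
        module
      · rw [← sub_eq_add_neg, ← smul_sub, inv_smul_eq_iff₀ hst']
        module
  obtain ⟨v₁, hv₁⟩ := LinearMap.BilinForm.exists_orthogonal_basis (B := b.restrict E₁)
    ⟨fun x y => hb.eq x y⟩
  obtain ⟨v₂, hv₂⟩ := LinearMap.BilinForm.exists_orthogonal_basis (B := b.restrict E₂)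
    ⟨fun x y => hb.eq x y⟩
  have cross (u w : U) (hu : u ∈ E₁) (hw : w ∈ E₂) : b u w = 0 := by
    have h := hT u w
    rw [(mem₁ u).mp hu, (mem₂ w).mp hw] at h
    simp only [map_smul, LinearMap.smul_apply, smul_eq_mul] at h
    exact (mul_eq_zero.mp (show (s - t) * b u w = 0 by linarith)).resolve_left hst'
  set w := (v₁.prod v₂).map (Submodule.prodEquivOfIsCompl E₁ E₂ hE) with hw
  have w_inl (i) : w (Sum.inl i) = v₁ i := by simp [hw]
  have w_inr (i) : w (Sum.inr i) = v₂ i := by simp [hw]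
  let e := (Fintype.equivFinOfCardEq (Module.finrank_eq_card_basis w).symm)
  have hortho : b.IsOrthoᵢ w := by
    rintro (i | i) (j | j) hij
    · simpa [Function.onFun, w_inl] using hv₁ (show i ≠ j by rintro rfl; exact hij rfl)
    · simpa [Function.onFun, w_inl, w_inr] using cross _ _ (v₁ i).2 (v₂ j).2
    · simpa [Function.onFun, w_inl, w_inr] using
        (hb.eq _ _).symm.trans (cross _ _ (v₁ j).2 (v₂ i).2)
    · simpa [Function.onFun, w_inr] using hv₂ (show i ≠ j by rintro rfl; exact hij rfl)
  refine ⟨w.reindex e, fun i => Sum.elim (fun _ => s) (fun _ => t) (e.symm i), fun i => ?_,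
    fun i => ?_, fun i j hij => ?_⟩
  · dsimp only
    rcases e.symm i with j | j <;> simp
  · rw [Basis.reindex_apply]
    dsimp only
    rcases e.symm i with j | j
    · rw [w_inl]
      exact (mem₁ _).mp (v₁ j).2
    · rw [w_inr]
      exact (mem₂ _).mp (v₂ j).2
  · simpa [Function.onFun] using hortho (e.symm.injective.ne hij)

/-- Coordinates in which a nondegenerate symmetric form is `∑ ± pᵢ qᵢ` and a self-adjoint operator
annihilated by `(X - s)(X - t)` is diagonal. -/
theorem exists_diagonal_coordinates {U : Type*} [AddCommGroup U] [Module ℝ U]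
    [FiniteDimensional ℝ U] {n : ℕ} (hn : finrank ℝ U = n) {b : LinearMap.BilinForm ℝ U}
    (hb : b.IsSymm) (hnd : b.SeparatingLeft) {T : U →ₗ[ℝ] U}
    (hT : ∀ u v, b (T u) v = b u (T v)) {s t : ℝ} (hst : s ≠ t)
    (hq : ∀ u, T (T u) - (s + t) • T u + (s * t) • u = 0) :
    ∃ (φ : (Fin n → ℝ) ≃ₗ[ℝ] U) (ε τ : Fin n → ℝ),
      (∀ i, ε i = 1 ∨ ε i = -1) ∧ (∀ i, τ i = s ∨ τ i = t) ∧
      (∀ p q, b (φ p) (φ q) = ∑ i, ε i * p i * q i) ∧ ∀ p, T (φ p) = φ (τ * p) := by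
  subst hn
  obtain ⟨v, τ, hτ, hTv, hv⟩ := exists_orthogonal_eigenbasis hb hT hst hq
  have hne (i) : b (v i) (v i) ≠ 0 := hv.not_isOrtho_basis_self_of_separatingLeft hnd i
  set r : Fin (finrank ℝ U) → ℝ := fun i => (√|b (v i) (v i)|)⁻¹
  have hr (i) : r i ≠ 0 := inv_ne_zero (Real.sqrt_ne_zero'.mpr (abs_pos.mpr (hne i)))
  set w := v.isUnitSMul (fun i => (hr i).isUnit)
  have hw (i) : w i = r i • v i := Basis.isUnitSMul_apply _ i
  have hφ (p) : w.equivFun.symm p = ∑ i, p i • w i := w.equivFun_symm_apply p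
  refine ⟨w.equivFun.symm, fun i => SignType.sign (b (v i) (v i)), τ, fun i => ?_, hτ,
    fun p q => ?_, fun p => ?_⟩
  · rcases (hne i).lt_or_gt with h | h <;> simp [h]
  · rw [hφ p, hφ q, map_sum b, LinearMap.sum_apply]
    refine Finset.sum_congr rfl fun i _ => ?_
    rw [map_sum, Finset.sum_eq_single i]
    · simp only [map_smul, LinearMap.smul_apply, smul_eq_mul, hw]
      have h₁ : r i * r i * |b (v i) (v i)| = 1 := by
        have := Real.mul_self_sqrt (abs_nonneg (b (v i) (v i)))
        have h₂ : √|b (v i) (v i)| ≠ 0 := Real.sqrt_ne_zero'.mpr (abs_pos.mpr (hne i))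
        simp only [r]
        field_simp
        linarith
      have h₂ := sign_mul_abs (b (v i) (v i))
      linear_combination (SignType.sign (b (v i) (v i)) : ℝ) * p i * q i * h₁ -
        q i * p i * r i * r i * h₂
    · intro j _ hji
      have : b (v i) (v j) = 0 := hv hji.symm
      simp [hw, this]
    · simp
  · rw [hφ, hφ, map_sum]
    refine Finset.sum_congr rfl fun i _ => ?_
    rw [map_smul, hw, map_smul, hTv, Pi.mul_apply]
    module

section Graph

variable {V : Type*} [AddCommGroup V] [Module ℝ V] {U W P Q : Submodule ℝ V}

/-- A common complement of `U` and `W` is the graph of an isomorphism `U ≃ W`. -/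
theorem exists_graph_equiv [FiniteDimensional ℝ V] (hQU : IsCompl Q U)
    (hQW : IsCompl Q W) (hd : finrank ℝ U = finrank ℝ W) :
    ∃ C : U ≃ₗ[ℝ] W, ∀ (u : U) (w : W), (u : V) + w ∈ Q ↔ w = C u := by
  set f : U →ₗ[ℝ] W := -(W.projectionOnto Q hQW.symm ∘ₗ U.subtype) with hf
  have mem_f (u : U) : (u : V) + f u ∈ Q := by
    have h := sub_projection_mem hQW.symm (u : V)
    rw [projection_apply] at h
    simpa [hf, sub_eq_add_neg] using h
  have unique (u : U) (w : W) (h : (u : V) + w ∈ Q) : w = f u := by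
    have h₁ : ((w - f u : W) : V) ∈ Q := by
      have := Q.sub_mem h (mem_f u)
      simpa using this
    have h₂ := Submodule.disjoint_def.mp hQW.disjoint _ h₁ (w - f u).2
    exact sub_eq_zero.mp (Subtype.ext h₂)
  have inj : Function.Injective f := by
    rw [injective_iff_map_eq_zero]
    intro u hu
    have h := mem_f u
    rw [hu, ZeroMemClass.coe_zero, add_zero] at h
    exact Subtype.ext (Submodule.disjoint_def.mp hQU.disjoint _ h u.2)
  refine ⟨f.linearEquivOfInjective inj hd, fun u w => ⟨unique u w, ?_⟩⟩
  rintro rfl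
  exact mem_f u

theorem exists_mem_of_crossRatio_eq_smul {U₁ U₂ U₃ U₄ : Submodule ℝ V} {h₁₂ : IsCompl U₁ U₂}
    {h₃₄ : IsCompl U₃ U₄} {l : ℝ} (h : crossRatio U₁ U₂ U₃ U₄ h₁₂ h₃₄ = l • LinearMap.id)
    {u : V} (hu : u ∈ U₁) : ∃ a ∈ U₃, u - a ∈ U₄ ∧ a - l • u ∈ U₂ := by
  refine ⟨U₃.projection U₄ h₃₄ u, projection_apply_mem h₃₄ u, sub_projection_mem h₃₄ u, ?_⟩
  have h₁ : U₁.projection U₂ h₁₂ (U₃.projection U₄ h₃₄ u) = l • u :=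
    congrArg (Subtype.val : U₁ → V) (LinearMap.congr_fun h ⟨u, hu⟩)
  rw [← h₁]
  exact sub_projection_mem h₁₂ _

theorem smul_add_smul_mem_of_crossRatio_eq_smul {h₁ : IsCompl U W} {h₂ : IsCompl P Q} {l : ℝ}
    (h : crossRatio U W P Q h₁ h₂ = l • LinearMap.id) {C : U ≃ₗ[ℝ] W}
    (hC : ∀ (u : U) (w : W), (u : V) + w ∈ Q ↔ w = C u) (u : U) :
    l • (u : V) + (l - 1) • (C u : V) ∈ P := by
  obtain ⟨a, haP, haQ, haW⟩ := exists_mem_of_crossRatio_eq_smul h u.2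
  have h₃ := (hC ((1 - l) • u) (-⟨a - l • u, haW⟩)).mp (by
    convert haQ using 1
    simp only [coe_smul, NegMemClass.coe_neg]
    module)
  have h₄ : -(a - l • (u : V)) = (1 - l) • (C u : V) := by
    have := congrArg (Subtype.val : W → V) h₃
    simpa only [map_smul, coe_smul, NegMemClass.coe_neg] using this
  convert haP using 1
  rw [← sub_eq_zero] at h₄ ⊢
  rw [← h₄]
  module

/-- The quadratic relation satisfied by `B⁻¹ ∘ D`, where `Q` and `Q'` are the graphs of `B`
and `D`. -/
theorem quadratic_relation_of_crossRatio {P' Q' : Submodule ℝ V} {l₁ l₂ l₃ : ℝ}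
    (hUW : IsCompl U W) {hPQ : IsCompl P Q} {hPQ' : IsCompl P' Q'} (hPW : Disjoint P' W)
    {B D : U ≃ₗ[ℝ] W}
    (hB : ∀ (u : U) (w : W), (u : V) + w ∈ Q ↔ w = B u)
    (hD : ∀ (u : U) (w : W), (u : V) + w ∈ Q' ↔ w = D u)
    (hP : ∀ u : U, l₃ • (u : V) + (l₃ - 1) • (B u : V) ∈ P)
    (hP' : ∀ u : U, l₂ • (u : V) + (l₂ - 1) • (D u : V) ∈ P')
    (h : crossRatio P Q P' Q' hPQ hPQ' = l₁ • LinearMap.id)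
    {T : U →ₗ[ℝ] U} (hT : ∀ u, B (T u) = D u) (u : U) :
    (l₃ * (1 - l₂)) • T (T u) +
      (2 * l₂ * l₃ - l₁ - l₂ - l₃ + 1) • T u + (l₂ * (1 - l₃)) • u = 0 := by
  obtain ⟨c, hcP, hcQ, hcm⟩ := exists_mem_of_crossRatio_eq_smul h (hP u)
  obtain ⟨⟨v, w⟩, hvw⟩ := (prodEquivOfIsCompl U W hUW).surjective
    (l₃ • (u : V) + (l₃ - 1) • (B u : V) - c)
  rw [coe_prodEquivOfIsCompl'] at hvw
  dsimp only at hvw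
  rw [← hvw, hD] at hcQ
  subst hcQ
  obtain rfl : c = l₃ • (u : V) + (l₃ - 1) • (B u : V) - (v + D v) := by rw [hvw]; abel
  have e₁ : ((1 - l₁) * (l₃ - 1)) • B u - D v = B (((1 - l₁) * l₃) • u - v) := by
    rw [← hB]
    convert hcm using 1
    simp only [coe_smul, AddSubgroupClass.coe_sub]
    module
  have e₂ : l₂ • ((l₃ - 1) • B u - D v) - (l₂ - 1) • D (l₃ • u - v) = 0 := by
    refine Subtype.ext (Submodule.disjoint_def.mp hPW _ ?_ (Subtype.prop _))
    convert P'.sub_mem (P'.smul_mem l₂ hcP) (hP' (l₃ • u - v)) using 1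
    simp only [coe_smul, AddSubgroupClass.coe_sub]
    module
  have f₁ : ((1 - l₁) * (l₃ - 1)) • u - T v - (((1 - l₁) * l₃) • u - v) = 0 := by
    apply B.injective
    rw [← hT, ← sub_eq_zero] at e₁
    rw [map_zero, ← e₁]
    simp only [map_sub, map_smul]
  have f₂ : l₂ • ((l₃ - 1) • u - T v) - (l₂ - 1) • T (l₃ • u - v) = 0 := by
    apply B.injective
    rw [← hT, ← hT] at e₂
    rw [map_zero, ← e₂]
    simp only [map_sub, map_smul]
  have hv : v = (1 - l₁) • u + T v := by
    rw [← sub_eq_zero, ← f₁]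
    module
  have hTv : T v = (l₂ * (l₃ - 1)) • u - ((l₂ - 1) * l₃) • T u := by
    rw [map_sub, map_smul] at f₂
    rw [← sub_eq_zero, ← neg_eq_zero, ← f₂]
    module
  have hTTv : T v = (1 - l₁) • T u + T (T v) := by
    conv_lhs => rw [hv]
    simp only [map_add, map_smul]
  rw [hTv, map_sub, map_smul, map_smul, ← sub_eq_zero, ← neg_eq_zero] at hTTv
  rw [← hTTv]
  module

end Graph

section Symplectic

variable {n : ℕ}

/-- The standard symplectic form as a bilinear form. -/
def omegaForm (n : ℕ) : LinearMap.BilinForm ℝ (SympV n) :=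
  LinearMap.mk₂ ℝ (stdOmega n)
    (fun p p' q => by
      simp only [stdOmega, Prod.fst_add, Prod.snd_add, Pi.add_apply, add_mul,
        Finset.sum_add_distrib]
      ring)
    (fun c p q => by
      simp only [stdOmega, Prod.smul_fst, Prod.smul_snd, Pi.smul_apply, smul_eq_mul, mul_assoc,
        ← Finset.mul_sum]
      ring)
    (fun p q q' => by
      simp only [stdOmega, Prod.fst_add, Prod.snd_add, Pi.add_apply, mul_add,
        Finset.sum_add_distrib]
      ring)
    (fun c p q => by
      simp only [stdOmega, Prod.smul_fst, Prod.smul_snd, Pi.smul_apply, smul_eq_mul,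
        mul_left_comm _ c, ← Finset.mul_sum]
      ring)

theorem omegaForm_apply (p q : SympV n) : omegaForm n p q = stdOmega n p q := rfl

theorem omegaForm_swap (p q : SympV n) : omegaForm n q p = -omegaForm n p q := by
  simp only [omegaForm_apply, stdOmega, mul_comm (q.1 _), mul_comm (q.2 _)]
  ring

theorem eq_zero_of_omegaForm_eq_zero {p : SympV n} (h : ∀ q, omegaForm n p q = 0) : p = 0 := by
  ext i
  · simpa [omegaForm_apply, stdOmega, Pi.single_apply] using h (0, Pi.single i 1)
  · simpa [omegaForm_apply, stdOmega, Pi.single_apply] using h (Pi.single i 1, 0)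

variable {U W Q : Submodule ℝ (SympV n)}

theorem IsLagrangian.omegaForm_eq_zero (h : IsLagrangian n U) {u v : SympV n} (hu : u ∈ U)
    (hv : v ∈ U) : omegaForm n u v = 0 :=
  h.2 u hu v hv

theorem omegaForm_graph_comm (hU : IsLagrangian n U) (hW : IsLagrangian n W)
    (hQ : IsLagrangian n Q) {C : U ≃ₗ[ℝ] W}
    (hC : ∀ (u : U) (w : W), (u : SympV n) + w ∈ Q ↔ w = C u) (u v : U) :
    omegaForm n u (C v) = omegaForm n v (C u) := by
  have h := hQ.omegaForm_eq_zero ((hC u _).mpr rfl) ((hC v _).mpr rfl)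
  simp only [map_add, LinearMap.add_apply, hU.omegaForm_eq_zero u.2 v.2,
    hW.omegaForm_eq_zero (C u).2 (C v).2, omegaForm_swap (v : SympV n) (C u)] at h
  linarith

/-- The subspace `{(a p, b δ p)}` of `ℝⁿ × ℝⁿ`, with `δ` acting diagonally. -/
def diagSubspace (a b : ℝ) (δ : Fin n → ℝ) : Submodule ℝ (SympV n) :=
  LinearMap.range ((a • LinearMap.id).prod (b • LinearMap.mulLeft ℝ δ))

theorem eq_map_diagSubspace (hU : finrank ℝ U = n) (g : SympV n ≃ₗ[ℝ] SympV n) {a b : ℝ}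
    {δ : Fin n → ℝ} (hab : a ≠ 0 ∨ b ≠ 0) (hδ : ∀ i, δ i ≠ 0)
    (hg : ∀ p : Fin n → ℝ, g (a • p, b • (δ * p)) ∈ U) :
    U = (diagSubspace a b δ).map (g : SympV n →ₗ[ℝ] SympV n) := by
  symm
  have inj : Function.Injective ((a • LinearMap.id).prod (b • LinearMap.mulLeft ℝ δ)) := by
    rw [injective_iff_map_eq_zero]
    intro p hp
    obtain ⟨h₁, h₂⟩ : a • p = 0 ∧ b • (δ * p) = 0 := Prod.mk_eq_zero.mp hp
    rcases hab with h | h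
    · exact (smul_eq_zero.mp h₁).resolve_left h
    · ext i
      have := congrFun ((smul_eq_zero.mp h₂).resolve_left h) i
      exact (mul_eq_zero.mp this).resolve_left (hδ i)
  apply Submodule.eq_of_le_of_finrank_eq
  · rw [Submodule.map_le_iff_le_comap]
    rintro _ ⟨p, rfl⟩
    exact hg p
  · rw [hU, LinearEquiv.finrank_map_eq g, diagSubspace, LinearMap.finrank_range_of_inj inj,
      finrank_fin_fun]

/-- Normal form of a tuple of Lagrangians with scalar cross-ratios. -/
def normalTuple (l₂ l₃ : ℝ) (ε τ : Fin n → ℝ) : Fin 3 → Bool → Submodule ℝ (SympV n)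
  | 0, true => diagSubspace 1 0 ε
  | 0, false => diagSubspace 0 1 ε
  | 1, true => diagSubspace l₃ (l₃ - 1) ε
  | 1, false => diagSubspace 1 1 ε
  | 2, true => diagSubspace l₂ (l₂ - 1) (ε * τ)
  | 2, false => diagSubspace 1 1 (ε * τ)

theorem exists_symplectic_of_coordinates (hU : IsLagrangian n U) (hW : IsLagrangian n W)
    (hUW : IsCompl U W) (B : U ≃ₗ[ℝ] W) (φ : (Fin n → ℝ) ≃ₗ[ℝ] U) {ε : Fin n → ℝ}
    (hε : ε * ε = 1) (hφ : ∀ p q, omegaForm n (φ p) (B (φ q)) = ∑ i, ε i * p i * q i) :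
    ∃ g : SympV n ≃ₗ[ℝ] SympV n, IsSymplectic n g ∧
      ∀ p q, g (p, q) = φ p + B (φ (ε * q)) := by
  let m : (Fin n → ℝ) ≃ₗ[ℝ] (Fin n → ℝ) := LinearEquiv.ofInvolutive (LinearMap.mulLeft ℝ ε)
    (fun p => by simp [← mul_assoc, hε])
  let g := (φ.prodCongr (m ≪≫ₗ φ ≪≫ₗ B)) ≪≫ₗ prodEquivOfIsCompl U W hUW
  have hg (p q) : g (p, q) = φ p + B (φ (ε * q)) :=
    coe_prodEquivOfIsCompl' U W hUW _
  have key (p q) : omegaForm n (φ p) (B (φ (ε * q))) = ∑ i, p i * q i := by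
    rw [hφ]
    refine Finset.sum_congr rfl fun i _ => ?_
    have : ε i * ε i = 1 := congrFun hε i
    rw [Pi.mul_apply]
    linear_combination p i * q i * this
  refine ⟨g, ?_, hg⟩
  rintro ⟨p, q⟩ ⟨p', q'⟩
  rw [← omegaForm_apply, hg, hg]
  simp only [map_add, LinearMap.add_apply, hU.omegaForm_eq_zero (φ p).2 (φ p').2,
    hW.omegaForm_eq_zero (B (φ (ε * q))).2 (B (φ (ε * q'))).2,
    omegaForm_swap (φ p' : SympV n) (B (φ (ε * q))), key, stdOmega, mul_comm (p' _)]
  ring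

/-- Every tuple of pairwise transverse Lagrangians with the given scalar cross-ratios is
symplectically equivalent to a normal form. -/
theorem GoodLagTuple.exists_eq_map_normalTuple {l₁ l₂ l₃ x y : ℝ} (hxy : x ≠ y)
    (hlead : l₃ * (1 - l₂) ≠ 0)
    (hx : l₃ * (1 - l₂) * x ^ 2 + (l₁ + l₂ - l₃ - 1) * x + (1 - l₁) = 0)
    (hy : l₃ * (1 - l₂) * y ^ 2 + (l₁ + l₂ - l₃ - 1) * y + (1 - l₁) = 0)
    {L : Fin 3 → Bool → Submodule ℝ (SympV n)} (hL : GoodLagTuple n l₁ l₂ l₃ L) :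
    ∃ ε τ : Fin n → ℝ, (∀ i, ε i = 1 ∨ ε i = -1) ∧ (∀ i, τ i = 1 - x ∨ τ i = 1 - y) ∧
      ∃ g : SympV n ≃ₗ[ℝ] SympV n, IsSymplectic n g ∧
        ∀ i b, L i b = (normalTuple l₂ l₃ ε τ i b).map (g : SympV n →ₗ[ℝ] SympV n) := by
  obtain ⟨hlag, hcompl, h₁, h₂, h₃⟩ := hL
  have hUW := hcompl 0 true 0 false (by simp)
  have hU := hlag 0 true
  have hW := hlag 0 false
  have hd := hU.1.trans hW.1.symm
  have c₁ := hcompl 1 true 1 false (by simp)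
  have c₂ := hcompl 2 true 2 false (by simp)
  obtain ⟨B, hB⟩ := exists_graph_equiv (hcompl 1 false 0 true (by simp))
    (hcompl 1 false 0 false (by simp)) hd
  obtain ⟨D, hD⟩ := exists_graph_equiv (hcompl 2 false 0 true (by simp))
    (hcompl 2 false 0 false (by simp)) hd
  have hP := smul_add_smul_mem_of_crossRatio_eq_smul (h₃ hUW c₁) hB
  have hP' := smul_add_smul_mem_of_crossRatio_eq_smul (h₂ hUW c₂) hD
  set T : L 0 true ≃ₗ[ℝ] L 0 true := D ≪≫ₗ B.symm with hTdef
  have hT (u) : B (T u) = D u := by simp [hTdef]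
  have hquad := quadratic_relation_of_crossRatio hUW (hcompl 2 true 0 false (by simp)).disjoint
    hB hD hP hP' (h₁ c₁ c₂) (T := T) hT
  have commB := omegaForm_graph_comm hU hW (hlag 1 false) hB
  have commD := omegaForm_graph_comm hU hW (hlag 2 false) hD
  set b : LinearMap.BilinForm ℝ (L 0 true) := (omegaForm n).compl₁₂ (L 0 true).subtype
    ((L 0 false).subtype ∘ₗ (B : L 0 true →ₗ[ℝ] L 0 false)) with hb
  have b_apply (u v) : b u v = omegaForm n u (B v) := rfl
  have bsymm : b.IsSymm := ⟨fun u v => commB u v⟩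
  have bsep : b.SeparatingLeft := by
    intro u hu
    refine Subtype.ext (eq_zero_of_omegaForm_eq_zero fun q => ?_)
    obtain ⟨⟨v, w⟩, rfl⟩ := (prodEquivOfIsCompl _ _ hUW).surjective q
    obtain ⟨v', rfl⟩ := B.surjective w
    rw [coe_prodEquivOfIsCompl', map_add, hU.omegaForm_eq_zero u.2 v.2, zero_add]
    exact hu v'
  have bT (u v) : b (T u) v = b u (T v) := by
    rw [b_apply, b_apply, commB, hT, hT, commD]
  have hxy' : x - y ≠ 0 := sub_ne_zero.mpr hxy
  have hsum : l₃ * (1 - l₂) * (x + y) = -(l₁ + l₂ - l₃ - 1) := by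
    apply mul_left_cancel₀ hxy'
    linear_combination hx - hy
  have hprod : l₃ * (1 - l₂) * (x * y) = 1 - l₁ := by
    linear_combination x * hsum - hx
  have hTquad (u) : T (T u) - ((1 - x) + (1 - y)) • T u + ((1 - x) * (1 - y)) • u = 0 := by
    apply (smul_eq_zero.mp _).resolve_left hlead
    rw [← hquad u]
    have e₁ : l₃ * (1 - l₂) * ((1 - x) + (1 - y)) = -(2 * l₂ * l₃ - l₁ - l₂ - l₃ + 1) := by
      linear_combination -hsum
    have e₂ : l₃ * (1 - l₂) * ((1 - x) * (1 - y)) = l₂ * (1 - l₃) := by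
      linear_combination hprod - hsum
    rw [smul_add, smul_sub, smul_smul, smul_smul, e₁, e₂, neg_smul, sub_neg_eq_add]
    rfl
  obtain ⟨φ, ε, τ, hε, hτ, hφ, hTφ'⟩ := exists_diagonal_coordinates hU.1 bsymm bsep
    (T := T) bT (s := 1 - x) (t := 1 - y) (by simpa using hxy) hTquad
  have hTφ (p) : T (φ p) = φ (τ * p) := hTφ' p
  have hε₀ (i) : ε i ≠ 0 := by rcases hε i with h | h <;> simp [h]
  have hεε : ε * ε = 1 := by
    ext i
    rcases hε i with h | h <;> simp [h]
  have hτ₀ (i) : τ i ≠ 0 := by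
    intro h
    have h₀ : τ * Pi.single i 1 = 0 := by
      ext j
      rcases eq_or_ne j i with rfl | hj
      · simp [h]
      · simp [hj]
    have : (Pi.single i 1 : Fin n → ℝ) = 0 := by
      apply φ.injective
      apply T.injective
      rw [hTφ, h₀, map_zero, map_zero]
    simpa using congrFun this i
  have hετ₀ (i) : (ε * τ) i ≠ 0 := mul_ne_zero (hε₀ i) (hτ₀ i)
  obtain ⟨g, hg, hgφ⟩ := exists_symplectic_of_coordinates hU hW hUW B φ hεε hφ
  have hgB (a c : ℝ) (p) : g (a • p, c • (ε * p)) = a • (φ p : SympV n) + c • B (φ p) := by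
    rw [hgφ, mul_smul_comm, ← mul_assoc, hεε, one_mul]
    simp
  have hgD (a c : ℝ) (p) : g (a • p, c • (ε * τ * p)) = a • (φ p : SympV n) + c • D (φ p) := by
    rw [mul_assoc, hgφ, mul_smul_comm, ← mul_assoc, hεε, one_mul, ← hT, hTφ]
    simp
  have hl₃ : l₃ ≠ 0 := left_ne_zero_of_mul hlead
  have hl₂ : l₂ - 1 ≠ 0 := by
    rw [← neg_ne_zero, neg_sub]
    exact right_ne_zero_of_mul hlead
  refine ⟨ε, τ, hε, hτ, g, hg, fun i b => ?_⟩
  fin_cases i <;> cases b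
  · exact eq_map_diagSubspace hW.1 g (.inr one_ne_zero) hε₀ fun p => by rw [hgB]; simp
  · exact eq_map_diagSubspace hU.1 g (.inl one_ne_zero) hε₀ fun p => by rw [hgB]; simp
  · refine eq_map_diagSubspace (hlag 1 false).1 g (.inl one_ne_zero) hε₀ fun p => ?_
    rw [hgB, one_smul, one_smul]
    exact (hB _ _).mpr rfl
  · refine eq_map_diagSubspace (hlag 1 true).1 g (.inl hl₃) hε₀ fun p => ?_
    rw [hgB]
    exact hP _
  · refine eq_map_diagSubspace (hlag 2 false).1 g (.inl one_ne_zero) hετ₀ fun p => ?_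
    rw [hgD, one_smul, one_smul]
    exact (hD _ _).mpr rfl
  · refine eq_map_diagSubspace (hlag 2 true).1 g (.inr hl₂) hετ₀ fun p => ?_
    rw [hgD]
    exact hP' _

theorem IsSymplectic.symm {g : SympV n ≃ₗ[ℝ] SympV n} (hg : IsSymplectic n g) :
    IsSymplectic n g.symm := fun u v => by
  rw [← hg, g.apply_symm_apply, g.apply_symm_apply]

theorem IsSymplectic.trans {g h : SympV n ≃ₗ[ℝ] SympV n} (hg : IsSymplectic n g)
    (hh : IsSymplectic n h) : IsSymplectic n (g ≪≫ₗ h) := fun _ _ =>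
  (hh _ _).trans (hg _ _)

end Symplectic

/-- If finitely many types classify the elements of `S` up to `r`, then finitely many elements of
`S` represent all types that occur. -/
theorem exists_finite_representatives {α κ : Type*} {S : Set α} {K : Set κ} (hK : K.Finite)
    (r : α → κ → Prop) (h : ∀ a ∈ S, ∃ k ∈ K, r a k) :
    ∃ F : Set α, F.Finite ∧ F ⊆ S ∧ ∀ a ∈ S, ∃ a₀ ∈ F, ∃ k, r a k ∧ r a₀ k := by
  have hex (k : {k ∈ K | ∃ a ∈ S, r a k}) : ∃ a ∈ S, r a k := k.2.2
  choose f hfS hfr using hex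
  have : Finite {k ∈ K | ∃ a ∈ S, r a k} := (hK.subset (Set.sep_subset _ _)).to_subtype
  refine ⟨Set.range f, Set.finite_range f, Set.range_subset_iff.mpr hfS, fun a ha => ?_⟩
  obtain ⟨k, hk, hak⟩ := h a ha
  exact ⟨_, ⟨⟨k, hk, a, ha, hak⟩, rfl⟩, k, hak, hfr _⟩

theorem stmt18 (n : ℕ) (l1 l2 l3 : ℝ)
    (x y : ℝ) (hxy : x ≠ y) (hlead : l3 * (1 - l2) ≠ 0)
    (hx : l3 * (1 - l2) * x ^ 2 + (l1 + l2 - l3 - 1) * x + (1 - l1) = 0)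
    (hy : l3 * (1 - l2) * y ^ 2 + (l1 + l2 - l3 - 1) * y + (1 - l1) = 0) :
    ∃ F : Set (Fin 3 → Bool → Submodule ℝ (SympV n)), F.Finite ∧
      (∀ L ∈ F, GoodLagTuple n l1 l2 l3 L) ∧
      ∀ L, GoodLagTuple n l1 l2 l3 L →
        ∃ L₀ ∈ F, ∃ g : SympV n ≃ₗ[ℝ] SympV n, IsSymplectic n g ∧
          ∀ i b, L i b = (L₀ i b).map (g : SympV n →ₗ[ℝ] SympV n) := by
  have hpi (s t : ℝ) : {f : Fin n → ℝ | ∀ i, f i = s ∨ f i = t}.Finite :=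
    (Set.Finite.pi' fun _ => Set.toFinite {s, t}).subset fun f hf i => hf i
  obtain ⟨F, hF, hFS, hrep⟩ := exists_finite_representatives
    (S := {L | GoodLagTuple n l1 l2 l3 L}) ((hpi 1 (-1)).prod (hpi (1 - x) (1 - y)))
    (fun L k => ∃ g : SympV n ≃ₗ[ℝ] SympV n, IsSymplectic n g ∧
      ∀ i b, L i b = (normalTuple l2 l3 k.1 k.2 i b).map (g : SympV n →ₗ[ℝ] SympV n))
    (fun L hL => by
      obtain ⟨ε, τ, hε, hτ, h⟩ :=
        GoodLagTuple.exists_eq_map_normalTuple hxy hlead hx hy hL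
      exact ⟨(ε, τ), ⟨hε, hτ⟩, h⟩)
  refine ⟨F, hF, hFS, fun L hL => ?_⟩
  obtain ⟨L₀, hL₀, k, ⟨g, hg, hgL⟩, g₀, hg₀, hgL₀⟩ := hrep L hL
  refine ⟨L₀, hL₀, g₀.symm ≪≫ₗ g, hg₀.symm.trans hg, fun i b => ?_⟩
  rw [hgL, hgL₀, ← Submodule.map_comp]
  congr 1
  exact LinearMap.ext fun v => by simp
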